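/- Define k-linear maps d₁ : A⁴ → A, d_even : A⁴ → A⁴ and d_odd : A⁴ → A⁴ by d₁(v₀,v₁,v₂,v₃) = x₁v₀ + x₂v₁ + y₁v₂ + y₂v₃; d_even(v₀,v₁,v₂,v₃) = (x₂v₀ − y₂v₂, x₁v₁ − y₁v₃, (y₁−1)v₀ + x₁v₂, (y₂−1)v₁ + x₂v₃); d_odd(v₀,v₁,v₂,v₃) = (x₁v₀ + y₁v₂, x₂v₁ + y₂v₃, (1−y₂)v₀ + x₂v₂, (1−y₁)v₁ + x₁v₃). Then the sequence ⋯ → A⁴ →(d_odd) A⁴ →(d_even) A⁴ →(d₁) A →(ε_A) k → 0, in which the differentials from degree 2 onward alternate d_even, d_odd, d_even, d_odd, …, is exact: ε_A is surjective; the kernel of ε_A equals the image of d₁; the kernel of d₁ equals the image of d_even; the kernel of d_even equals the image of d_odd; and the kernel of d_odd equals the image of d_even. (All maps are homomorphisms of right A-modules, A⁴ being a free right A-module, so this is a free resolution of the trivial right A-module k.) -/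

import Mathlib

noncomputable section

/-- The augmentation ideal of an augmented `k`-algebra, as a `k`-submodule. -/
def augIdeal {k A : Type*} [CommRing k] [Ring A] [Algebra k A] (ε : A →ₐ[k] k) :
    Submodule k A :=
  LinearMap.ker ε.toLinearMap

variable (k : Type*) [CommRing k]

/-- The generators `x₁, x₂, y₁, y₂` of the free algebra `F` on four generators:
`x₁ = Xg k 0`, `x₂ = Xg k 1`, `y₁ = Xg k 2`, `y₂ = Xg k 3`. -/
def Xg (i : Fin 4) : FreeAlgebra k (Fin 4) := FreeAlgebra.ι k i

/-- `r₁ = x₁x₂ + y₁² − y₁`. -/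
def r1 : FreeAlgebra k (Fin 4) := Xg k 0 * Xg k 1 + Xg k 2 * Xg k 2 - Xg k 2
/-- `r₂ = x₂x₁ + y₂² − y₂`. -/
def r2 : FreeAlgebra k (Fin 4) := Xg k 1 * Xg k 0 + Xg k 3 * Xg k 3 - Xg k 3
/-- `r₃ = x₁y₂ − y₁x₁`. -/
def r3 : FreeAlgebra k (Fin 4) := Xg k 0 * Xg k 3 - Xg k 2 * Xg k 0
/-- `r₄ = x₂y₁ − y₂x₂`. -/
def r4 : FreeAlgebra k (Fin 4) := Xg k 1 * Xg k 2 - Xg k 3 * Xg k 1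

/-- The relations of `B = F/(r₁, r₂)`. -/
def relB : FreeAlgebra k (Fin 4) → FreeAlgebra k (Fin 4) → Prop := fun a b =>
  (a = r1 k ∨ a = r2 k) ∧ b = 0

/-- The relations of `A = F/(r₁, r₂, r₃, r₄)`. -/
def relA : FreeAlgebra k (Fin 4) → FreeAlgebra k (Fin 4) → Prop := fun a b =>
  (a = r1 k ∨ a = r2 k ∨ a = r3 k ∨ a = r4 k) ∧ b = 0

/-- `B = F/(r₁, r₂)`. -/
def AlgB : Type _ := RingQuot (relB k)
/-- `A = F/(r₁, r₂, r₃, r₄)`. -/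
def AlgA : Type _ := RingQuot (relA k)

instance : Ring (AlgB k) := by unfold AlgB; infer_instance
instance : Algebra k (AlgB k) := by unfold AlgB; infer_instance
instance : Ring (AlgA k) := by unfold AlgA; infer_instance
instance : Algebra k (AlgA k) := by unfold AlgA; infer_instance

/-- The projection `F → B`. -/
def mkB : FreeAlgebra k (Fin 4) →ₐ[k] AlgB k := RingQuot.mkAlgHom k (relB k)
/-- The projection `F → A`. -/
def mkA : FreeAlgebra k (Fin 4) →ₐ[k] AlgA k := RingQuot.mkAlgHom k (relA k)

/-- The augmentation of `B`, sending every generator to `0`. -/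
def εB : AlgB k →ₐ[k] k :=
  RingQuot.liftAlgHom k
    ⟨FreeAlgebra.lift k (fun _ => (0 : k)), by
      rintro a b ⟨h, rfl⟩
      rcases h with rfl | rfl <;> simp [r1, r2, Xg]⟩

/-- The augmentation of `A`, sending every generator to `0`. -/
def εA : AlgA k →ₐ[k] k :=
  RingQuot.liftAlgHom k
    ⟨FreeAlgebra.lift k (fun _ => (0 : k)), by
      rintro a b ⟨h, rfl⟩
      rcases h with rfl | rfl | rfl | rfl <;> simp [r1, r2, r3, r4, Xg]⟩

/-- The images `x₁, x₂, y₁, y₂` of the generators in `A`. -/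
def genA (i : Fin 4) : AlgA k := mkA k (Xg k i)

/-- `d₁ : A⁴ → A`, `(v₀,v₁,v₂,v₃) ↦ x₁v₀ + x₂v₁ + y₁v₂ + y₂v₃`. -/
def d1 (v : Fin 4 → AlgA k) : AlgA k :=
  genA k 0 * v 0 + genA k 1 * v 1 + genA k 2 * v 2 + genA k 3 * v 3

/-- The even differential `d_even : A⁴ → A⁴`. -/
def dEven (v : Fin 4 → AlgA k) : Fin 4 → AlgA k :=
  ![genA k 1 * v 0 - genA k 3 * v 2,
    genA k 0 * v 1 - genA k 2 * v 3,
    (genA k 2 - 1) * v 0 + genA k 0 * v 2,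
    (genA k 3 - 1) * v 1 + genA k 1 * v 3]

/-- The odd differential `d_odd : A⁴ → A⁴`. -/
def dOdd (v : Fin 4 → AlgA k) : Fin 4 → AlgA k :=
  ![genA k 0 * v 0 + genA k 2 * v 2,
    genA k 1 * v 1 + genA k 3 * v 3,
    (1 - genA k 3) * v 0 + genA k 1 * v 2,
    (1 - genA k 2) * v 1 + genA k 0 * v 3]

lemma mkA_surjective : Function.Surjective (mkA k) := RingQuot.mkAlgHom_surjective k (relA k)

lemma mkA_eq_zero {a : FreeAlgebra k (Fin 4)} (h : a = r1 k ∨ a = r2 k ∨ a = r3 k ∨ a = r4 k) :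
    mkA k a = 0 := by
  have := RingQuot.mkAlgHom_rel k (s := relA k) (x := a) (y := 0) ⟨h, rfl⟩
  rw [map_zero] at this
  exact this

lemma genA_rel₁ : genA k 0 * genA k 1 = genA k 2 - genA k 2 * genA k 2 := by
  have := mkA_eq_zero k (a := r1 k) (by simp)
  simp only [r1, map_sub, map_add, map_mul] at this
  rw [← sub_eq_zero, ← this]
  simp only [genA]
  noncomm_ring

lemma genA_rel₂ : genA k 1 * genA k 0 = genA k 3 - genA k 3 * genA k 3 := by
  have := mkA_eq_zero k (a := r2 k) (by simp)
  simp only [r2, map_sub, map_add, map_mul] at this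
  rw [← sub_eq_zero, ← this]
  simp only [genA]
  noncomm_ring

lemma genA_rel₃ : genA k 0 * genA k 3 = genA k 2 * genA k 0 := by
  have := mkA_eq_zero k (a := r3 k) (by simp)
  simp only [r3, map_sub, map_mul] at this
  exact sub_eq_zero.mp this

lemma genA_rel₄ : genA k 1 * genA k 2 = genA k 3 * genA k 1 := by
  have := mkA_eq_zero k (a := r4 k) (by simp)
  simp only [r4, map_sub, map_mul] at this
  exact sub_eq_zero.mp this

lemma εA_genA (i : Fin 4) : εA k (genA k i) = 0 := by
  simp only [εA, genA, mkA, Xg]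
  erw [RingQuot.liftAlgHom_mkAlgHom_apply]
  simp

variable {k} in
/-- Induction principle for `A`, presented by the generators `genA k i`. -/
lemma AlgA.induction {P : AlgA k → Prop} (algebraMap : ∀ c, P (algebraMap k (AlgA k) c))
    (genA : ∀ i, P (genA k i)) (add : ∀ a b, P a → P b → P (a + b))
    (mul : ∀ a b, P a → P b → P (a * b)) (a : AlgA k) : P a := by
  obtain ⟨f, rfl⟩ := mkA_surjective k a
  induction f using FreeAlgebra.induction with
  | grade0 c => simpa using algebraMap c
  | grade1 i => exact genA i
  | mul f g hf hg => simpa using mul _ _ hf hg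
  | add f g hf hg => simpa using add _ _ hf hg

/-- Every element of `A` is a scalar plus an element of the image of `d₁`. -/
lemma exists_eq_algebraMap_add_d1 (a : AlgA k) :
    ∃ v, a = algebraMap k (AlgA k) (εA k a) + d1 k v := by
  induction a using AlgA.induction with
  | algebraMap c => exact ⟨0, by simp [d1]⟩
  | genA i =>
    refine ⟨Pi.single i 1, ?_⟩
    rw [εA_genA]
    fin_cases i <;> simp [d1]
  | add a b ha hb =>
    obtain ⟨v, hv⟩ := ha
    obtain ⟨w, hw⟩ := hb
    refine ⟨v + w, ?_⟩
    calc a + b = (algebraMap k (AlgA k) (εA k a) + d1 k v)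
          + (algebraMap k (AlgA k) (εA k b) + d1 k w) := by rw [← hv, ← hw]
      _ = _ := by simp only [d1, map_add, Pi.add_apply]; noncomm_ring
  | mul a b ha hb =>
    obtain ⟨v, hv⟩ := ha
    obtain ⟨w, hw⟩ := hb
    refine ⟨fun i => v i * b + εA k a • w i, ?_⟩
    calc a * b = (algebraMap k (AlgA k) (εA k a) + d1 k v) * b := by rw [← hv]
      _ = εA k a • (algebraMap k (AlgA k) (εA k b) + d1 k w) + d1 k v * b := by
        rw [← hw, add_mul, Algebra.smul_def]
      _ = _ := by
        simp only [d1, map_mul, smul_add, mul_add, add_mul, mul_smul_comm, mul_assoc,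
          ← Algebra.smul_def]
        abel

lemma εA_d1 (v : Fin 4 → AlgA k) : εA k (d1 k v) = 0 := by
  simp [d1, εA_genA]

lemma d1_dEven (v : Fin 4 → AlgA k) : d1 k (dEven k v) = 0 := by
  simp only [d1, dEven, Matrix.cons_val, mul_sub, mul_add, sub_mul, ← mul_assoc, one_mul,
    genA_rel₁, genA_rel₂, genA_rel₃, genA_rel₄]
  abel

/-- Extensionality for quadruples. -/
lemma eq_of_four {X : Type*} {v w : Fin 4 → X} (h₀ : v 0 = w 0) (h₁ : v 1 = w 1)
    (h₂ : v 2 = w 2) (h₃ : v 3 = w 3) : v = w := by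
  ext i
  fin_cases i <;> assumption

/-- `d_even` as a `k`-linear map. -/
def dEvenLinear : (Fin 4 → AlgA k) →ₗ[k] (Fin 4 → AlgA k) where
  toFun := dEven k
  map_add' v w := by
    refine eq_of_four ?_ ?_ ?_ ?_ <;> simp [dEven] <;> noncomm_ring
  map_smul' c v := by
    refine eq_of_four ?_ ?_ ?_ ?_ <;> simp [dEven, smul_sub]

/-- Right multiplication by `a` on `A⁴`. -/
def mulRightPi (a : AlgA k) : (Fin 4 → AlgA k) →ₗ[k] (Fin 4 → AlgA k) where
  toFun v i := v i * a
  map_add' v w := funext fun i => add_mul (v i) (w i) a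
  map_smul' c v := funext fun i => smul_mul_assoc c (v i) a

@[simp]
lemma mulRightPi_apply (a : AlgA k) (v : Fin 4 → AlgA k) (i : Fin 4) :
    mulRightPi k a v i = v i * a := rfl

lemma dEven_mulRightPi (a : AlgA k) (v : Fin 4 → AlgA k) :
    dEven k (mulRightPi k a v) = mulRightPi k a (dEven k v) := by
  refine eq_of_four ?_ ?_ ?_ ?_ <;> simp [dEven] <;> noncomm_ring

/-- The cokernel of `d_even`. -/
abbrev CokerEven : Type _ := (Fin 4 → AlgA k) ⧸ LinearMap.range (dEvenLinear k)

/-- Right multiplication by `a` on the cokernel of `d_even`. -/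
def mulRightCoker (a : AlgA k) : CokerEven k →ₗ[k] CokerEven k :=
  Submodule.mapQ _ _ (mulRightPi k a) <| by
    rintro _ ⟨w, rfl⟩
    exact ⟨mulRightPi k a w, dEven_mulRightPi k a w⟩

/-- The operator `(c, q) ↦ (0, c eᵢ + q gᵢ)` on `k ⊕ coker d_even`, where `gᵢ` is the `i`-th
generator of `A`. -/
def foxOperator (i : Fin 4) : Module.End k (k × CokerEven k) :=
  LinearMap.inr k k (CokerEven k) ∘ₗ
    LinearMap.coprod (LinearMap.toSpanSingleton k _ (Submodule.Quotient.mk (Pi.single i 1)))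
      (mulRightCoker k (genA k i))

lemma foxOperator_apply (i : Fin 4) (c : k) (v : Fin 4 → AlgA k) :
    foxOperator k i (c, Submodule.Quotient.mk v) =
      (0, Submodule.Quotient.mk (c • (Pi.single i 1 : Fin 4 → AlgA k) + mulRightPi k (genA k i) v)) := rfl

/-- The right `A`-module structure on `k ⊕ coker d_even` whose off-diagonal entry is the
universal Fox derivation `A → coker d_even`. -/
def foxRep : AlgA k →ₐ[k] (Module.End k (k × CokerEven k))ᵐᵒᵖ :=
  RingQuot.liftAlgHom k
    ⟨FreeAlgebra.lift k fun i => MulOpposite.op (foxOperator k i), by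
      have key (T : (Module.End k (k × CokerEven k))ᵐᵒᵖ)
          (h : ∀ c v, ∃ w, T.unop (c, Submodule.Quotient.mk v) =
            (0, Submodule.Quotient.mk (dEven k w))) : T = 0 := by
        apply MulOpposite.unop_injective
        refine LinearMap.ext fun ⟨c, q⟩ => ?_
        obtain ⟨v, rfl⟩ := Submodule.Quotient.mk_surjective _ q
        obtain ⟨w, hw⟩ := h c v
        have hz : (Submodule.Quotient.mk (dEven k w) : CokerEven k) = 0 :=
          (Submodule.Quotient.mk_eq_zero _).mpr ⟨w, rfl⟩
        rw [hw, hz]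
        rfl
      rintro a b ⟨h, rfl⟩
      rw [map_zero]
      apply key
      intro c v
      rcases h with rfl | rfl | rfl | rfl
      · refine ⟨c • Pi.single 0 1, ?_⟩
        simp only [r1, Xg, map_add, map_sub, map_mul, FreeAlgebra.lift_ι_apply,
          MulOpposite.unop_add, MulOpposite.unop_sub, MulOpposite.unop_mul, MulOpposite.unop_op,
          LinearMap.add_apply, LinearMap.sub_apply, Module.End.mul_apply, foxOperator_apply,
          Prod.mk_add_mk, Prod.mk_sub_mk, ← Submodule.Quotient.mk_add, ← Submodule.Quotient.mk_sub,
          sub_zero, add_zero]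
        congr 2
        refine eq_of_four ?_ ?_ ?_ ?_ <;> simp [dEven, mul_assoc, genA_rel₁, smul_sub, mul_sub] <;> abel
      · refine ⟨c • Pi.single 1 1, ?_⟩
        simp only [r2, Xg, map_add, map_sub, map_mul, FreeAlgebra.lift_ι_apply,
          MulOpposite.unop_add, MulOpposite.unop_sub, MulOpposite.unop_mul, MulOpposite.unop_op,
          LinearMap.add_apply, LinearMap.sub_apply, Module.End.mul_apply, foxOperator_apply,
          Prod.mk_add_mk, Prod.mk_sub_mk, ← Submodule.Quotient.mk_add, ← Submodule.Quotient.mk_sub,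
          sub_zero, add_zero]
        congr 2
        refine eq_of_four ?_ ?_ ?_ ?_ <;> simp [dEven, mul_assoc, genA_rel₂, smul_sub, mul_sub] <;> abel
      · refine ⟨-(c • Pi.single 2 1), ?_⟩
        simp only [r3, Xg, map_sub, map_mul, FreeAlgebra.lift_ι_apply,
          MulOpposite.unop_sub, MulOpposite.unop_mul, MulOpposite.unop_op,
          LinearMap.sub_apply, Module.End.mul_apply, foxOperator_apply,
          Prod.mk_sub_mk, ← Submodule.Quotient.mk_sub, sub_zero]
        congr 2
        refine eq_of_four ?_ ?_ ?_ ?_ <;> simp [dEven, mul_assoc, genA_rel₃]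
      · refine ⟨-(c • Pi.single 3 1), ?_⟩
        simp only [r4, Xg, map_sub, map_mul, FreeAlgebra.lift_ι_apply,
          MulOpposite.unop_sub, MulOpposite.unop_mul, MulOpposite.unop_op,
          LinearMap.sub_apply, Module.End.mul_apply, foxOperator_apply,
          Prod.mk_sub_mk, ← Submodule.Quotient.mk_sub, sub_zero]
        congr 2
        refine eq_of_four ?_ ?_ ?_ ?_ <;> simp [dEven, mul_assoc, genA_rel₄]⟩

lemma foxRep_genA (i : Fin 4) : foxRep k (genA k i) = MulOpposite.op (foxOperator k i) := by
  simp only [foxRep, genA, mkA, Xg]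
  erw [RingQuot.liftAlgHom_mkAlgHom_apply]
  simp

/-- On the second summand, `foxRep` is right multiplication. -/
lemma foxRep_inr (a : AlgA k) (v : Fin 4 → AlgA k) :
    (foxRep k a).unop (0, Submodule.Quotient.mk v) =
      (0, Submodule.Quotient.mk (mulRightPi k a v)) := by
  induction a using AlgA.induction generalizing v with
  | algebraMap c =>
    have : mulRightPi k (algebraMap k (AlgA k) c) v = c • v := by
      ext i
      simp [Algebra.smul_def, Algebra.commutes]
    rw [this, AlgHom.commutes, MulOpposite.algebraMap_apply, MulOpposite.unop_op,
      Module.algebraMap_end_apply, Prod.smul_mk, smul_zero, Submodule.Quotient.mk_smul]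
  | genA i => rw [foxRep_genA, MulOpposite.unop_op, foxOperator_apply, zero_smul, zero_add]
  | add a b ha hb =>
    have : mulRightPi k (a + b) v = mulRightPi k a v + mulRightPi k b v := by
      ext i
      simp [mul_add]
    rw [this, map_add, MulOpposite.unop_add, LinearMap.add_apply, ha, hb, Prod.mk_add_mk,
      add_zero, Submodule.Quotient.mk_add]
  | mul a b ha hb =>
    have : mulRightPi k (a * b) v = mulRightPi k b (mulRightPi k a v) := by
      ext i
      simp [mul_assoc]
    rw [this, map_mul, MulOpposite.unop_mul, Module.End.mul_apply, ha, hb]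

lemma foxRep_genA_mul (i : Fin 4) (a : AlgA k) :
    (foxRep k (genA k i * a)).unop (1, 0) = (0, Submodule.Quotient.mk (Pi.single i a)) := by
  rw [map_mul, MulOpposite.unop_mul, Module.End.mul_apply, foxRep_genA, MulOpposite.unop_op,
    ← Submodule.Quotient.mk_zero, foxOperator_apply, map_zero, add_zero, one_smul, foxRep_inr]
  congr 2
  ext j
  by_cases h : j = i
  · subst h; simp
  · simp [h]

/-- The Fox derivation recovers a vector `v` modulo the image of `d_even` from `d₁ v`. -/
lemma foxRep_d1 (v : Fin 4 → AlgA k) :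
    (foxRep k (d1 k v)).unop (1, 0) = (0, Submodule.Quotient.mk v) := by
  simp only [d1, map_add (foxRep k), MulOpposite.unop_add, LinearMap.add_apply, foxRep_genA_mul,
    Prod.mk_add_mk, add_zero, ← Submodule.Quotient.mk_add]
  congr 2
  refine eq_of_four ?_ ?_ ?_ ?_ <;> simp

lemma dEven_dOdd (v : Fin 4 → AlgA k) : dEven k (dOdd k v) = 0 := by
  refine eq_of_four ?_ ?_ ?_ ?_ <;>
    simp [dEven, dOdd, mul_add, sub_mul, mul_sub, ← mul_assoc,
      genA_rel₁, genA_rel₂, genA_rel₃, genA_rel₄] <;> abel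

lemma dOdd_dEven (v : Fin 4 → AlgA k) : dOdd k (dEven k v) = 0 := by
  refine eq_of_four ?_ ?_ ?_ ?_ <;>
    simp [dEven, dOdd, mul_add, sub_mul, mul_sub, ← mul_assoc,
      genA_rel₁, genA_rel₂, genA_rel₃, genA_rel₄]

variable {k} in
lemma dOdd_swap_eq_of_dEven_eq_zero {v : Fin 4 → AlgA k} (h : dEven k v = 0) :
    dOdd k ![v 2, v 3, v 0, v 1] = v := by
  refine eq_of_four ?_ ?_ ?_ ?_
  · have := congrFun h 2
    simp only [dEven, dOdd, Matrix.cons_val, Pi.zero_apply, sub_mul, one_mul] at this ⊢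
    rw [← sub_eq_zero, ← this]
    noncomm_ring
  · have := congrFun h 3
    simp only [dEven, dOdd, Matrix.cons_val, Pi.zero_apply, sub_mul, one_mul] at this ⊢
    rw [← sub_eq_zero, ← this]
    noncomm_ring
  · have := congrFun h 0
    simp only [dEven, dOdd, Matrix.cons_val, Pi.zero_apply, sub_mul, one_mul] at this ⊢
    rw [← sub_eq_zero, ← this]
    noncomm_ring
  · have := congrFun h 1
    simp only [dEven, dOdd, Matrix.cons_val, Pi.zero_apply, sub_mul, one_mul] at this ⊢
    rw [← sub_eq_zero, ← this]
    noncomm_ring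

variable {k} in
lemma dEven_neg_swap_eq_of_dOdd_eq_zero {v : Fin 4 → AlgA k} (h : dOdd k v = 0) :
    dEven k ![-v 2, -v 3, -v 0, -v 1] = v := by
  refine eq_of_four ?_ ?_ ?_ ?_
  · have := congrFun h 2
    simp only [dEven, dOdd, Matrix.cons_val, Pi.zero_apply, sub_mul, one_mul] at this ⊢
    rw [← sub_eq_zero, ← neg_eq_zero, ← this]
    noncomm_ring
  · have := congrFun h 3
    simp only [dEven, dOdd, Matrix.cons_val, Pi.zero_apply, sub_mul, one_mul] at this ⊢
    rw [← sub_eq_zero, ← neg_eq_zero, ← this]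
    noncomm_ring
  · have := congrFun h 0
    simp only [dEven, dOdd, Matrix.cons_val, Pi.zero_apply, sub_mul, one_mul] at this ⊢
    rw [← sub_eq_zero, ← neg_eq_zero, ← this]
    noncomm_ring
  · have := congrFun h 1
    simp only [dEven, dOdd, Matrix.cons_val, Pi.zero_apply, sub_mul, one_mul] at this ⊢
    rw [← sub_eq_zero, ← neg_eq_zero, ← this]
    noncomm_ring

/-- The sequence `⋯ → A⁴ →(d_odd) A⁴ →(d_even) A⁴ →(d₁) A →(ε_A) k → 0`, with the
differentials from degree `2` on alternating `d_even, d_odd, d_even, …`, is exact: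
it is a free resolution of the trivial right `A`-module `k`. -/
theorem resolution_exact :
    Function.Surjective (εA k)
    ∧ (∀ a : AlgA k, εA k a = 0 ↔ ∃ v : Fin 4 → AlgA k, d1 k v = a)
    ∧ (∀ v : Fin 4 → AlgA k, d1 k v = 0 ↔ ∃ w : Fin 4 → AlgA k, dEven k w = v)
    ∧ (∀ v : Fin 4 → AlgA k, dEven k v = 0 ↔ ∃ w : Fin 4 → AlgA k, dOdd k w = v)
    ∧ (∀ v : Fin 4 → AlgA k, dOdd k v = 0 ↔ ∃ w : Fin 4 → AlgA k, dEven k w = v) := by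
  refine ⟨fun c => ⟨algebraMap k _ c, by simp⟩, fun a => ⟨fun h => ?_, ?_⟩,
    fun v => ⟨fun h => ?_, ?_⟩,
    fun v => ⟨fun h => ⟨_, dOdd_swap_eq_of_dEven_eq_zero h⟩, ?_⟩,
    fun v => ⟨fun h => ⟨_, dEven_neg_swap_eq_of_dOdd_eq_zero h⟩, ?_⟩⟩
  · obtain ⟨v, hv⟩ := exists_eq_algebraMap_add_d1 k a
    exact ⟨v, by rw [hv, h, map_zero, zero_add]⟩
  · rintro ⟨v, rfl⟩
    exact εA_d1 k v
  · have hv := foxRep_d1 k v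
    rw [h, map_zero] at hv
    exact (Submodule.Quotient.mk_eq_zero _).mp (congrArg Prod.snd hv).symm
  · rintro ⟨w, rfl⟩
    exact d1_dEven k w
  · rintro ⟨w, rfl⟩
    exact dEven_dOdd k w
  · rintro ⟨w, rfl⟩
    exact dOdd_dEven k w
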